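/- arXiv:2402.01500 — 2 statements merged into one kernel-verified Lean document; each statement's English description precedes it below -/
import Mathlib

section
/- Let M be a unitary magma. The smallest set of noncrossing M-cliques containing the unit clique and all M-triangles and closed under all partial compositions ∘_i is the set of all noncrossing M-cliques. Moreover this generating set is minimal: no M-triangle belongs to the closure under partial compositions of the unit clique together with the remaining M-triangles. -/
/-! Bundled `M`-cliques for a unitary magma `M` (modeled as `MulOneClass`), with
1-indexed vertices `1, …, arity+1`, and their partial composition. -/

/-- A (bundled) `M`-clique: an arity `n ≥ 1` together with a labeling of the arcs
`(x,y)`, `1 ≤ x < y ≤ n+1`, by elements of `M`; the labeling is normalized to take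
the value `1` outside of this domain, so that equality of cliques is equality of
arities and labelings. -/
structure Cl (M : Type) [One M] where
  arity : ℕ
  lab : ℕ → ℕ → M
  norm : ∀ x y : ℕ, ¬(1 ≤ x ∧ x < y ∧ y ≤ arity + 1) → lab x y = 1

namespace Cl

/-- The unit clique: the unique noncrossing `M`-clique of arity 1. -/
def unitCl (M : Type) [One M] : Cl M :=
  ⟨1, fun _ _ => 1, fun _ _ _ => rfl⟩

variable {M : Type} [One M]

/-- `(x,y)` is a diagonal of `c`: an arc which is neither an edge `(i,i+1)` nor
the base `(1, arity+1)`. -/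
def IsDiag (c : Cl M) (x y : ℕ) : Prop :=
  1 ≤ x ∧ x < y ∧ y ≤ c.arity + 1 ∧ y ≠ x + 1 ∧ ¬(x = 1 ∧ y = c.arity + 1)

/-- A clique is noncrossing when no two of its solid diagonals cross. -/
def Noncrossing (c : Cl M) : Prop :=
  ∀ x y x' y' : ℕ, c.IsDiag x y → c.IsDiag x' y' →
    c.lab x y ≠ 1 → c.lab x' y' ≠ 1 →
    ¬((x < x' ∧ x' < y ∧ y < y') ∨ (x' < x ∧ x < y' ∧ y' < y))

/-- A bubble is a clique all of whose diagonals are labeled by the unit. -/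
def IsBubble (c : Cl M) : Prop := ∀ x y : ℕ, c.IsDiag x y → c.lab x y = 1

/-- Partial composition `p ∘ᵢ q` of cliques: glue the base of `q` onto the `i`-th
edge of `p`; the glued arc `(i, i + arity q)` is labeled `pᵢ ⋆ q₀`, the other arcs
of `p` and `q` keep their labels on their images, and all remaining arcs are
labeled by the unit. -/
def comp {M : Type} [MulOneClass M] (p : Cl M) (i : ℕ) (q : Cl M) : Cl M where
  arity := p.arity + q.arity - 1
  lab := fun x y =>
    if 1 ≤ x ∧ x < y ∧ y ≤ (p.arity + q.arity - 1) + 1 then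
      if x = i ∧ y = i + q.arity then
        p.lab i (i + 1) * q.lab 1 (q.arity + 1)
      else if i ≤ x ∧ y ≤ i + q.arity then
        q.lab (x - i + 1) (y - i + 1)
      else if (x ≤ i ∨ i + q.arity ≤ x) ∧ (y ≤ i ∨ i + q.arity ≤ y) then
        p.lab (if x ≤ i then x else x + 1 - q.arity)
          (if y ≤ i then y else y + 1 - q.arity)
      else 1
    else 1
  norm := fun _ _ h => if_neg h

end Cl

/-- The closure of a set `S` of cliques under all partial compositions `∘ᵢ`
(with valid composition positions `1 ≤ i ≤ arity`). -/
inductive Gen {M : Type} [MulOneClass M] (S : Set (Cl M)) : Cl M → Prop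
  | base {c : Cl M} : c ∈ S → Gen S c
  | comp {p q : Cl M} (i : ℕ) :
      Gen S p → Gen S q → 1 ≤ i → i ≤ p.arity → Gen S (p.comp i q)

/-- The set of all noncrossing `M`-cliques: cliques of arity `≥ 1` which are
noncrossing, with the convention that the unique one of arity 1 is the unit clique. -/
def NCSet (M : Type) [One M] : Set (Cl M) :=
  {c : Cl M | 1 ≤ c.arity ∧ c.Noncrossing ∧ (c.arity = 1 → c = Cl.unitCl M)}

/-- The set of `M`-triangles: the cliques of arity 2. -/
def TriSet (M : Type) [One M] : Set (Cl M) := {c : Cl M | c.arity = 2}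

namespace Cl

theorem ext_arity_lab {M : Type} [One M] {c d : Cl M} (ha : c.arity = d.arity)
    (hl : ∀ x y, 1 ≤ x → x < y → y ≤ c.arity + 1 → c.lab x y = d.lab x y) : c = d := by
  have hlab : c.lab = d.lab := by
    funext x y
    by_cases h : 1 ≤ x ∧ x < y ∧ y ≤ c.arity + 1
    · exact hl x y h.1 h.2.1 h.2.2
    · rw [c.norm x y h, d.norm x y (ha ▸ h)]
  cases c
  cases d
  simp_all

theorem comp_unitCl {M : Type} [MulOneClass M] (p : Cl M) (i : ℕ) :
    p.comp i (unitCl M) = p := by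
  refine ext_arity_lab (by simp [comp, unitCl]) fun x y hx hxy hy => ?_
  simp only [comp, unitCl, mul_one, Nat.add_sub_cancel] at hy ⊢
  rw [if_pos ⟨hx, hxy, hy⟩]
  split_ifs <;> congr 1 <;> omega

theorem unitCl_comp {M : Type} [MulOneClass M] (q : Cl M) :
    (unitCl M).comp 1 q = q := by
  refine ext_arity_lab (by simp [comp, unitCl]) fun x y hx hxy hy => ?_
  simp only [comp, unitCl, one_mul, Nat.add_sub_cancel_left] at hy ⊢
  rw [if_pos ⟨hx, hxy, by omega⟩]
  split_ifs <;> congr 1 <;> omega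

theorem arity_comp {M : Type} [MulOneClass M] (p q : Cl M) (i : ℕ) :
    (p.comp i q).arity = p.arity + q.arity - 1 := rfl

/-- A solid diagonal of `p ∘ᵢ q` is the glued arc, the image of a diagonal of `q`, or the
image of a diagonal of `p`. -/
theorem isDiag_comp_cases {M : Type} [MulOneClass M] {p q : Cl M} {i x y : ℕ}
    (hq : 1 ≤ q.arity) (hi : 1 ≤ i) (hip : i ≤ p.arity)
    (hd : (p.comp i q).IsDiag x y) (hl : (p.comp i q).lab x y ≠ 1) :
    (x = i ∧ y = i + q.arity) ∨
    (∃ u v, x = u + i - 1 ∧ y = v + i - 1 ∧ q.IsDiag u v ∧ q.lab u v ≠ 1) ∨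
    (∃ u v, x = (if u ≤ i then u else u + q.arity - 1) ∧
      y = (if v ≤ i then v else v + q.arity - 1) ∧ p.IsDiag u v ∧ p.lab u v ≠ 1) := by
  obtain ⟨h1, h2, h3, h4, h5⟩ := hd
  simp only [arity_comp] at h3 h5
  simp only [comp] at hl
  rw [if_pos ⟨h1, h2, h3⟩] at hl
  by_cases hg : x = i ∧ y = i + q.arity
  · exact Or.inl hg
  rw [if_neg hg] at hl
  by_cases hin : i ≤ x ∧ y ≤ i + q.arity
  · rw [if_pos hin] at hl
    refine Or.inr (Or.inl ⟨_, _, ?_, ?_, ⟨?_, ?_, ?_, ?_, ?_⟩, hl⟩) <;> omega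
  rw [if_neg hin] at hl
  by_cases hout : (x ≤ i ∨ i + q.arity ≤ x) ∧ (y ≤ i ∨ i + q.arity ≤ y)
  · rw [if_pos hout] at hl
    refine Or.inr (Or.inr ⟨_, _, ?_, ?_, ⟨?_, ?_, ?_, ?_, ?_⟩, hl⟩) <;> grind
  · exact absurd (if_neg hout) hl

theorem Noncrossing.comp {M : Type} [MulOneClass M] {p q : Cl M} {i : ℕ}
    (hp : p.Noncrossing) (hq : q.Noncrossing) (hqa : 1 ≤ q.arity) (hi : 1 ≤ i)
    (hip : i ≤ p.arity) : (p.comp i q).Noncrossing := by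
  intro x y x' y' hd hd' hl hl'
  rcases isDiag_comp_cases hqa hi hip hd hl with
    ⟨rfl, rfl⟩ | ⟨u, v, rfl, rfl, hu, huv⟩ | ⟨u, v, rfl, rfl, hu, huv⟩ <;>
  rcases isDiag_comp_cases hqa hi hip hd' hl' with
    ⟨hx, hy⟩ | ⟨u', v', rfl, rfl, hu', huv'⟩ | ⟨u', v', rfl, rfl, hu', huv'⟩
  · omega
  · obtain ⟨_, _, _, _, _⟩ := hu'
    omega
  · obtain ⟨_, _, _, _, _⟩ := hu'
    split_ifs <;> omega
  · obtain ⟨_, _, _, _, _⟩ := hu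
    omega
  · have h := hq u v u' v' hu hu' huv huv'
    obtain ⟨_, _, _, _, _⟩ := hu
    obtain ⟨_, _, _, _, _⟩ := hu'
    omega
  · obtain ⟨_, _, _, _, _⟩ := hu
    obtain ⟨_, _, _, _, _⟩ := hu'
    split_ifs <;> omega
  · obtain ⟨_, _, _, _, _⟩ := hu
    split_ifs <;> omega
  · obtain ⟨_, _, _, _, _⟩ := hu
    obtain ⟨_, _, _, _, _⟩ := hu'
    split_ifs <;> omega
  · have h := hp u v u' v' hu hu' huv huv'
    obtain ⟨_, _, _, _, _⟩ := hu
    obtain ⟨_, _, _, _, _⟩ := hu'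
    split_ifs <;> omega

/-- The part of `c` spanned by the vertices `a, …, a + m`. -/
def inner {M : Type} [One M] (c : Cl M) (a m : ℕ) : Cl M where
  arity := m
  lab := fun x y =>
    if 1 ≤ x ∧ x < y ∧ y ≤ m + 1 then c.lab (x + a - 1) (y + a - 1) else 1
  norm := fun _ _ h => if_neg h

/-- The part of `c` outside the arc `(a, a + m)`, that arc becoming an unlabeled edge. -/
def outer {M : Type} [One M] (c : Cl M) (a m : ℕ) : Cl M where
  arity := c.arity + 1 - m
  lab := fun x y =>
    if (1 ≤ x ∧ x < y ∧ y ≤ c.arity + 1 - m + 1) ∧ ¬(x = a ∧ y = a + 1) then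
      c.lab (if x ≤ a then x else x + m - 1) (if y ≤ a then y else y + m - 1)
    else 1
  norm := fun _ _ h => if_neg fun h' => h h'.1

theorem inner_lab {M : Type} [One M] (c : Cl M) (a m x y : ℕ) :
    (c.inner a m).lab x y =
      if 1 ≤ x ∧ x < y ∧ y ≤ m + 1 then c.lab (x + a - 1) (y + a - 1) else 1 := rfl

theorem outer_lab {M : Type} [One M] (c : Cl M) (a m x y : ℕ) :
    (c.outer a m).lab x y =
      if (1 ≤ x ∧ x < y ∧ y ≤ c.arity + 1 - m + 1) ∧ ¬(x = a ∧ y = a + 1) then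
        c.lab (if x ≤ a then x else x + m - 1) (if y ≤ a then y else y + m - 1)
      else 1 := rfl

theorem Noncrossing.inner {M : Type} [One M] {c : Cl M} {a m : ℕ} (hc : c.Noncrossing)
    (ha : 1 ≤ a) (ham : a + m ≤ c.arity + 1) : (c.inner a m).Noncrossing := by
  have key : ∀ x y, (c.inner a m).IsDiag x y → (c.inner a m).lab x y ≠ 1 →
      c.IsDiag (x + a - 1) (y + a - 1) ∧ c.lab (x + a - 1) (y + a - 1) ≠ 1 := by
    rintro x y ⟨h1, h2, h3, h4, h5⟩ hl
    simp only [Cl.inner] at h3 h5 hl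
    rw [if_pos ⟨h1, h2, h3⟩] at hl
    refine ⟨⟨?_, ?_, ?_, ?_, ?_⟩, hl⟩ <;> omega
  intro x y x' y' hd hd' hl hl'
  have h := hc _ _ _ _ (key x y hd hl).1 (key x' y' hd' hl').1 (key x y hd hl).2
    (key x' y' hd' hl').2
  obtain ⟨_, _, _, _, _⟩ := hd
  obtain ⟨_, _, _, _, _⟩ := hd'
  omega

theorem Noncrossing.outer {M : Type} [One M] {c : Cl M} {a m : ℕ} (hc : c.Noncrossing)
    (hm : 1 ≤ m) (ham : a + m ≤ c.arity + 1) : (c.outer a m).Noncrossing := by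
  have key : ∀ x y, (c.outer a m).IsDiag x y → (c.outer a m).lab x y ≠ 1 →
      c.IsDiag (if x ≤ a then x else x + m - 1) (if y ≤ a then y else y + m - 1) ∧
      c.lab (if x ≤ a then x else x + m - 1) (if y ≤ a then y else y + m - 1) ≠ 1 := by
    rintro x y ⟨h1, h2, h3, h4, h5⟩ hl
    simp only [Cl.outer] at h3 h5 hl
    rw [if_pos ⟨⟨h1, h2, h3⟩, by omega⟩] at hl
    refine ⟨⟨?_, ?_, ?_, ?_, ?_⟩, hl⟩ <;> split_ifs <;> omega
  intro x y x' y' hd hd' hl hl'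
  have h := hc _ _ _ _ (key x y hd hl).1 (key x' y' hd' hl').1 (key x y hd hl).2
    (key x' y' hd' hl').2
  obtain ⟨_, _, _, _, _⟩ := hd
  obtain ⟨_, _, _, _, _⟩ := hd'
  split_ifs at h <;> omega

/-- A clique is recovered by gluing its two parts along an arc that no solid diagonal
crosses. -/
theorem outer_comp_inner {M : Type} [MulOneClass M] {c : Cl M} {a m : ℕ} (ha : 1 ≤ a)
    (hm : 2 ≤ m) (hmc : m < c.arity) (ham : a + m ≤ c.arity + 1)
    (hcross : ∀ x y, c.IsDiag x y → c.lab x y ≠ 1 →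
      ¬((x < a ∧ a < y ∧ y < a + m) ∨ (a < x ∧ x < a + m ∧ a + m < y))) :
    (c.outer a m).comp a (c.inner a m) = c := by
  have hin_arity : (c.inner a m).arity = m := rfl
  have hout_arity : (c.outer a m).arity = c.arity + 1 - m := rfl
  refine ext_arity_lab (by rw [arity_comp]; omega) fun x y hx hxy hy => ?_
  rw [arity_comp] at hy
  simp only [comp]
  rw [if_pos ⟨hx, hxy, hy⟩]
  by_cases hg : x = a ∧ y = a + (c.inner a m).arity
  · obtain ⟨rfl, rfl⟩ := hg
    rw [if_pos ⟨rfl, rfl⟩, outer_lab, inner_lab, if_neg (by omega), one_mul,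
      if_pos (by omega)]
    congr 1 <;> omega
  rw [if_neg hg]
  by_cases hin : a ≤ x ∧ y ≤ a + (c.inner a m).arity
  · rw [if_pos hin, inner_lab, if_pos (by omega)]
    congr 1 <;> omega
  rw [if_neg hin]
  by_cases hout : (x ≤ a ∨ a + (c.inner a m).arity ≤ x) ∧
      (y ≤ a ∨ a + (c.inner a m).arity ≤ y)
  · rw [if_pos hout, outer_lab, if_pos (by split_ifs <;> omega)]
    congr 1 <;> split_ifs <;> omega
  · rw [if_neg hout]
    by_contra hl
    refine hcross x y ⟨hx, hxy, ?_, ?_, ?_⟩ (Ne.symm hl) ?_ <;> omega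

/-- A noncrossing clique of arity at least `3` has a diagonal crossed by no solid
diagonal. -/
theorem Noncrossing.exists_uncrossed {M : Type} [One M] {c : Cl M} (hc : c.Noncrossing)
    (h3 : 3 ≤ c.arity) : ∃ a m, 1 ≤ a ∧ 2 ≤ m ∧ m < c.arity ∧ a + m ≤ c.arity + 1 ∧
      ∀ x y, c.IsDiag x y → c.lab x y ≠ 1 →
        ¬((x < a ∧ a < y ∧ y < a + m) ∨ (a < x ∧ x < a + m ∧ a + m < y)) := by
  by_cases hb : c.IsBubble
  · exact ⟨1, 2, le_rfl, le_rfl, by omega, by omega, fun x y hd hl => absurd (hb x y hd) hl⟩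
  · simp only [IsBubble, not_forall] at hb
    obtain ⟨a, b, hd, hl⟩ := hb
    have hd' := hd
    obtain ⟨h1, h2, h3, h4, h5⟩ := hd'
    refine ⟨a, b - a, h1, by omega, by omega, by omega, fun x y hxy hlxy => ?_⟩
    have h := hc _ _ _ _ hd hxy hl hlxy
    omega

end Cl

theorem mem_NCSet_of_gen {M : Type} [MulOneClass M] {c : Cl M}
    (h : Gen ({Cl.unitCl M} ∪ TriSet M) c) : c ∈ NCSet M := by
  induction h with
  | base h =>
    rcases h with rfl | h
    · refine ⟨le_rfl, fun x y x' y' _ _ hl => absurd rfl hl, fun _ => rfl⟩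
    · have h2 : _ = 2 := h
      refine ⟨by omega, fun x y x' y' hd => ?_, fun h1 => by omega⟩
      obtain ⟨_, _, _, _, _⟩ := hd
      omega
  | @comp p q i _ _ hi hip ihp ihq =>
    obtain ⟨hp1, hp, hpu⟩ := ihp
    obtain ⟨hq1, hq, hqu⟩ := ihq
    refine ⟨by rw [Cl.arity_comp]; omega, hp.comp hq hq1 hi hip, fun h1 => ?_⟩
    rw [Cl.arity_comp] at h1
    rw [hqu (by omega), Cl.comp_unitCl, hpu (by omega)]

theorem gen_of_mem_NCSet {M : Type} [MulOneClass M] {c : Cl M} (h : c ∈ NCSet M) :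
    Gen ({Cl.unitCl M} ∪ TriSet M) c := by
  induction hn : c.arity using Nat.strong_induction_on generalizing c with
  | _ n ih =>
    obtain ⟨h1, hc, hu⟩ := h
    by_cases e1 : c.arity = 1
    · exact .base (Or.inl (hu e1))
    by_cases e2 : c.arity = 2
    · exact .base (Or.inr e2)
    obtain ⟨a, m, ha, hm, hmc, ham, hcross⟩ := hc.exists_uncrossed (by omega)
    have hout : (c.outer a m).arity = c.arity + 1 - m := rfl
    have hin : (c.inner a m).arity = m := rfl
    rw [← Cl.outer_comp_inner ha hm hmc ham hcross]
    exact .comp a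
      (ih _ (by omega) ⟨by omega, hc.outer (by omega) ham, fun h => by omega⟩ rfl)
      (ih _ (by omega) ⟨by omega, hc.inner ha ham, fun h => by omega⟩ rfl) ha (by omega)

theorem ne_of_gen_diff {M : Type} [MulOneClass M] {t c : Cl M} (ht : t.arity = 2)
    (h : Gen ({Cl.unitCl M} ∪ (TriSet M \ {t})) c) :
    1 ≤ c.arity ∧ (c.arity = 1 → c = Cl.unitCl M) ∧ c ≠ t := by
  induction h with
  | base h =>
    rcases h with rfl | ⟨h, hne⟩
    · refine ⟨le_rfl, fun _ => rfl, ?_⟩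
      rintro rfl
      exact absurd ht (by simp [Cl.unitCl])
    · have h2 : _ = 2 := h
      exact ⟨by omega, fun _ => by omega, hne⟩
  | @comp p q i _ _ hi hip ihp ihq =>
    obtain ⟨hp1, hpu, hpt⟩ := ihp
    obtain ⟨hq1, hqu, hqt⟩ := ihq
    by_cases hq : q.arity = 1
    · rw [hqu hq, Cl.comp_unitCl]
      exact ⟨hp1, hpu, hpt⟩
    by_cases hp : p.arity = 1
    · obtain rfl : i = 1 := by omega
      rw [hpu hp, Cl.unitCl_comp]
      exact ⟨hq1, hqu, hqt⟩
    have ha := Cl.arity_comp p q i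
    refine ⟨by omega, fun _ => by omega, fun h => ?_⟩
    rw [h] at ha
    omega

/-- The closure under partial compositions of the unit clique together with all the
`M`-triangles is the set of all noncrossing `M`-cliques; moreover this generating
set is minimal: no `M`-triangle is generated by the unit clique together with the
remaining `M`-triangles. -/
theorem statement4 (M : Type) [MulOneClass M] :
    ({c : Cl M | Gen ({Cl.unitCl M} ∪ TriSet M) c} = NCSet M) ∧
    (∀ t : Cl M, t.arity = 2 → ¬ Gen ({Cl.unitCl M} ∪ (TriSet M \ {t})) t) := by
  exact ⟨Set.ext fun _ => ⟨mem_NCSet_of_gen, gen_of_mem_NCSet⟩,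
    fun _ ht h => (ne_of_gen_diff ht h).2.2 rfl⟩
end

section
/- Let M be a finite unitary magma with m := #M. For every n ≥ 2, the number of dual M-cliques of arity n equals Σ_{k=0}^{n−2} m^{n+1} · (m(m−1)+1)^k · (m(m−1))^{n−k−2} · nar(n,k). -/
/-! Noncrossing `M`-cliques for a unitary magma `M` (modeled as `MulOneClass`),
and the algebraic equation satisfied by their generating series. -/

/-- An arc of a polygon with `n+1` vertices (0-indexed vertices `0,…,n`),
given by a pair of vertices `x < y`.  For an `M`-clique of arity `n`,
this corresponds to the arcs `(x,y)` with `1 ≤ x < y ≤ n+1` (1-indexed). -/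
def Arc (n : ℕ) : Type := {a : Fin (n + 1) × Fin (n + 1) // a.1 < a.2}

/-- An `M`-clique of arity `n`: a labeling of all arcs by elements of `M`. -/
def CliqueLab (M : Type) (n : ℕ) : Type := Arc n → M

namespace Arc

/-- The base: the arc `(0, n)` (0-indexed), i.e. `(1, n+1)` (1-indexed). -/
def IsBase {n : ℕ} (a : Arc n) : Prop := (a.val.1 : ℕ) = 0 ∧ (a.val.2 : ℕ) = n

/-- The edges: the arcs `(i, i+1)`. -/
def IsEdge {n : ℕ} (a : Arc n) : Prop := (a.val.2 : ℕ) = (a.val.1 : ℕ) + 1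

/-- A diagonal: an arc which is neither the base nor an edge. -/
def IsDiagonal {n : ℕ} (a : Arc n) : Prop := ¬ a.IsBase ∧ ¬ a.IsEdge

/-- Two arcs cross if `x < x' < y < y'` or `x' < x < y' < y`. -/
def Cross {n : ℕ} (a b : Arc n) : Prop :=
  ((a.val.1 : ℕ) < (b.val.1 : ℕ) ∧ (b.val.1 : ℕ) < (a.val.2 : ℕ) ∧
      (a.val.2 : ℕ) < (b.val.2 : ℕ)) ∨
  ((b.val.1 : ℕ) < (a.val.1 : ℕ) ∧ (a.val.1 : ℕ) < (b.val.2 : ℕ) ∧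
      (b.val.2 : ℕ) < (a.val.2 : ℕ))

end Arc

/-- An `M`-clique is noncrossing if no two of its solid diagonals cross. -/
def Noncrossing {M : Type} [One M] {n : ℕ} (p : CliqueLab M n) : Prop :=
  ∀ a b : Arc n, a.IsDiagonal → b.IsDiagonal → p a ≠ 1 → p b ≠ 1 → ¬ a.Cross b

/-- The type of noncrossing `M`-cliques of arity `n`.  By convention there is exactly
one noncrossing `M`-clique of arity `1`: the unit clique, whose only arc is labeled
by the unit of `M`. -/
def NCClique (M : Type) [One M] (n : ℕ) : Type :=
  {p : CliqueLab M n // Noncrossing p ∧ (n = 1 → ∀ a, p a = 1)}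

/-- The number of noncrossing `M`-cliques of arity `n`. -/
noncomputable def ncCount (M : Type) [One M] (n : ℕ) : ℕ := Nat.card (NCClique M n)

/-- A dual `M`-clique of arity `n`: a labeling of all arcs by pairs of elements
of `M` such that the base and all edges are labeled by pairs `(a,a)`, every
diagonal whose label is different from `(1,1)` is labeled by a pair `(a,b)` with
`a ≠ b`, and no two diagonals with labels different from `(1,1)` cross. -/
def DualOK {M : Type} [One M] {n : ℕ} (p : Arc n → M × M) : Prop :=
  (∀ a : Arc n, (a.IsBase ∨ a.IsEdge) → (p a).1 = (p a).2) ∧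
  (∀ a : Arc n, a.IsDiagonal → p a ≠ (1, 1) → (p a).1 ≠ (p a).2) ∧
  (∀ a b : Arc n, a.IsDiagonal → b.IsDiagonal →
    p a ≠ (1, 1) → p b ≠ (1, 1) → ¬ a.Cross b)

/-- The type of dual `M`-cliques of arity `n`; by convention there is exactly one
dual `M`-clique of arity 1. -/
def DualClique (M : Type) [One M] (n : ℕ) : Type :=
  {p : Arc n → M × M // DualOK p ∧ (n = 1 → ∀ a, p a = (1, 1))}

/-- The number of dual `M`-cliques of arity `n`. -/
noncomputable def dualCount (M : Type) [One M] (n : ℕ) : ℕ := Nat.card (DualClique M n)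

/-- The Narayana number `nar(n,k) = (1/(n−1))·binom(n−1,k)·binom(n−1,k+1)`. -/
def nar (n k : ℕ) : ℕ := (n - 1).choose k * (n - 1).choose (k + 1) / (n - 1)

open PowerSeries in
/-- Lagrange inversion for the powers of the solution `E` of `E = X (1 + c E + d E²)`. -/
theorem natCast_mul_coeff_pow_of_eq_X_mul_quadratic (c d : ℚ) (E : ℚ⟦X⟧)
    (hE : E = X * (1 + C c * E + C d * E ^ 2)) (n r : ℕ) :
    (n : ℚ) * coeff n (E ^ r) = r * coeff n (X ^ r * (1 + C c * X + C d * X ^ 2) ^ n) := by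
  induction n generalizing r with
  | zero =>
    rcases r with _ | r <;> simp
  | succ n ih =>
    rcases r with _ | r
    · simp [coeff_one]
    set φ : ℚ⟦X⟧ := 1 + C c * X + C d * X ^ 2 with hφ
    have hstep : coeff (n + 1) (E ^ (r + 1)) =
        coeff n (E ^ r) + c * coeff n (E ^ (r + 1)) + d * coeff n (E ^ (r + 2)) := by
      have : E ^ (r + 1) = X * (E ^ r + C c * E ^ (r + 1) + C d * E ^ (r + 2)) := by
        calc E ^ (r + 1) = E ^ r * E := pow_succ _ _
          _ = E ^ r * (X * (1 + C c * E + C d * E ^ 2)) := by rw [← hE]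
          _ = _ := by ring
      refine (congrArg (coeff (n + 1)) this).trans ?_
      rw [coeff_succ_X_mul, map_add, map_add, coeff_C_mul, coeff_C_mul]
    have hsplit : coeff n (X ^ r * φ ^ (n + 1)) = coeff n (X ^ r * φ ^ n) +
        c * coeff n (X ^ (r + 1) * φ ^ n) + d * coeff n (X ^ (r + 2) * φ ^ n) := by
      have : X ^ r * φ ^ (n + 1) = X ^ r * φ ^ n + C c * (X ^ (r + 1) * φ ^ n) +
          C d * (X ^ (r + 2) * φ ^ n) := by
        rw [pow_succ φ, hφ]; ring
      rw [this]
      simp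
    have hshift : coeff (n + 1) (X ^ (r + 1) * φ ^ (n + 1)) = coeff n (X ^ r * φ ^ (n + 1)) := by
      rw [pow_succ', mul_assoc, coeff_succ_X_mul]
    have hderiv : coeff (n + 1) (X ^ (r + 1) * φ ^ (n + 1)) * ((n : ℚ) + 1) =
        (r + 1) * coeff n (X ^ r * φ ^ (n + 1)) + (n + 1) * (c * coeff n (X ^ (r + 1) * φ ^ n) +
          2 * (d * coeff n (X ^ (r + 2) * φ ^ n))) := by
      rw [← coeff_derivative]
      have hφ' : d⁄dX ℚ φ = C c + 2 * (C d * X) := by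
        simp [hφ, Derivation.leibniz, Derivation.leibniz_pow]
        ring
      have : d⁄dX ℚ (X ^ (r + 1) * φ ^ (n + 1)) =
          C ((r : ℚ) + 1) * (X ^ r * φ ^ (n + 1)) +
          C ((n : ℚ) + 1) * (C c * (X ^ (r + 1) * φ ^ n) + 2 * (C d * (X ^ (r + 2) * φ ^ n))) := by
        rw [Derivation.leibniz, Derivation.leibniz_pow, Derivation.leibniz_pow, hφ']
        simp
        ring
      rw [this, ← map_ofNat C 2, map_add]
      simp only [coeff_C_mul]
      rw [map_add]
      simp only [coeff_C_mul]
    rcases n with _ | n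
    · rw [hstep, hshift]
      have h0 : constantCoeff E = 0 := by rw [hE]; simp
      rcases r with _ | r <;> simp [h0, hφ]
    · have h1 := ih r
      have h2 := ih (r + 1)
      have h3 := ih (r + 2)
      have hn : ((n : ℚ) + 1) ≠ 0 := by positivity
      rw [hstep]
      push_cast at *
      apply mul_left_cancel₀ hn
      linear_combination (n + 2 : ℚ) * (h1 + c * h2 + d * h3) - (n + 2) * r * hsplit -
        hderiv + (1 - n * r - r) * hshift

open PowerSeries in
theorem mul_eq_sum_choose_of_convolution (w : ℚ) (D : ℕ → ℚ)
    (hD : ∀ n, 2 ≤ n → D n = ∑ j ∈ Finset.Icc 1 (n - 1),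
      (if j = 1 then 1 else w * D j) * (if n - j = 1 then 1 else (w + 1) * D (n - j)))
    (N : ℕ) (hN : 1 ≤ N) :
    (N : ℚ) * D (N + 1) = ∑ k ∈ Finset.range N,
      (w + 1) ^ k * w ^ (N - 1 - k) * (N.choose k * N.choose (k + 1)) := by
  set E : ℚ⟦X⟧ := mk fun n => if n = 0 then 0 else D (n + 1) with hE
  have hlin (a : ℚ) (i : ℕ) :
      coeff i (1 + C a * E) = if i + 1 = 1 then 1 else a * D (i + 1) := by
    rw [map_add, coeff_C_mul, hE, coeff_mk, coeff_one]
    rcases i with _ | i <;> simp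
  have hEq : E = X * ((1 + C w * E) * (1 + C (w + 1) * E)) := by
    ext n
    rcases n with _ | n
    · simp [hE]
    · rw [coeff_succ_X_mul, coeff_mul, Finset.Nat.sum_antidiagonal_eq_sum_range_succ_mk]
      simp only [hlin]
      rw [hE, coeff_mk, if_neg n.succ_ne_zero, hD (n + 1 + 1) (by omega)]
      refine Finset.sum_nbij' (· - 1) (· + 1) ?_ ?_ ?_ ?_ ?_
      · simp
      · simp
      · intro j hj
        exact Nat.sub_add_cancel (Finset.mem_Icc.1 hj).1
      · simp
      · intro j hj
        obtain ⟨hj1, hj2⟩ := Finset.mem_Icc.1 hj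
        obtain ⟨i, rfl⟩ : ∃ i, j = i + 1 := ⟨j - 1, by omega⟩
        obtain ⟨l, rfl⟩ : ∃ l, n = i + l := ⟨n - i, by omega⟩
        have hl : i + l + 1 + 1 - (i + 1) = l + 1 := by omega
        simp only [hl, Nat.add_sub_cancel, Nat.add_sub_cancel_left]
  have hlag := natCast_mul_coeff_pow_of_eq_X_mul_quadratic (w + (w + 1)) (w * (w + 1)) E
    (by conv_lhs => rw [hEq]
        simp only [map_add, map_mul]; ring) N 1
  have hcoeff : coeff N E = D (N + 1) := by
    simp [hE, Nat.one_le_iff_ne_zero.1 hN]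
  obtain ⟨M, rfl⟩ : ∃ M, N = M + 1 := ⟨N - 1, by omega⟩
  rw [pow_one, hcoeff, pow_one, Nat.cast_one, one_mul, coeff_succ_X_mul] at hlag
  have hfac : (1 + C (w + (w + 1)) * X + C (w * (w + 1)) * X ^ 2 : ℚ⟦X⟧) ^ (M + 1) =
      (1 + C (w + 1) * X) ^ (M + 1) * (1 + C w * X) ^ (M + 1) := by
    rw [← mul_pow]
    congr 1
    simp only [map_add, map_mul]
    ring
  have hbinom (a : ℚ) (i : ℕ) :
      coeff i ((1 + C a * X : ℚ⟦X⟧) ^ (M + 1)) = a ^ i * (M + 1).choose i := by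
    have : (1 + C a * X : ℚ⟦X⟧) ^ (M + 1) =
        rescale a (((1 + Polynomial.X : Polynomial ℚ) ^ (M + 1) : Polynomial ℚ) : ℚ⟦X⟧) := by
      simp [rescale_X]
    rw [this, coeff_rescale, Polynomial.coeff_coe, Polynomial.coeff_one_add_X_pow]
  rw [hlag, hfac, coeff_mul, Finset.Nat.sum_antidiagonal_eq_sum_range_succ_mk]
  refine Finset.sum_congr rfl fun k hk => ?_
  have hk' : k ≤ M := by simpa [Nat.lt_succ_iff] using hk
  rw [hbinom, hbinom, ← Nat.choose_symm_of_eq_add (n := M + 1) (a := k + 1) (b := M - k) (by omega)]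
  simp only [Nat.add_sub_cancel]
  ring

/-- `f` labels the arcs `(x, y)` with `x + 2 ≤ y ≤ n`, the nontrivial labels (those different from
`e`) belong to `S`, and no two nontrivially labeled arcs cross. -/
def IsDissection {L : Type*} (e : L) (S : Set L) (n : ℕ) (f : ℕ → ℕ → L) : Prop :=
  (∀ x y, f x y ≠ e → x + 2 ≤ y ∧ y ≤ n ∧ f x y ∈ S) ∧
  ∀ x y x' y', f x y ≠ e → f x' y' ≠ e → ¬ (x < x' ∧ x' < y ∧ y < y')

namespace IsDissection

variable {L : Type*} {e : L} {S : Set L}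

theorem finite_setOf [Finite L] (n : ℕ) : {f | IsDissection e S n f}.Finite := by
  refine Set.Finite.of_injOn (f := fun f (x y : Fin (n + 1)) => f x y) (t := Set.univ)
    (fun _ _ => Set.mem_univ _) ?_ Set.finite_univ
  intro f hf g hg hfg
  funext x y
  by_cases h : x ≤ n ∧ y ≤ n
  · exact congrFun (congrFun hfg ⟨x, by omega⟩) ⟨y, by omega⟩
  · have hf' : f x y = e := by
      by_contra h'
      have := hf.1 x y h'
      omega
    have hg' : g x y = e := by
      by_contra h'
      have := hg.1 x y h'
      omega
    rw [hf', hg']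

theorem setOf_one : {f | IsDissection e S 1 f} = {fun _ _ => e} := by
  ext f
  constructor
  · intro hf
    funext x y
    by_contra h
    have := hf.1 x y h
    omega
  · rintro rfl
    simp [IsDissection]

theorem ncard_base_ne (he : e ∉ S) {n : ℕ} (hn : 2 ≤ n) :
    {f | IsDissection e S n f ∧ f 0 n ≠ e}.ncard =
      S.ncard * {f | IsDissection e S n f ∧ f 0 n = e}.ncard := by
  classical
  rw [← Set.ncard_prod, ← Set.InjOn.ncard_image
    (f := fun q : L × (ℕ → ℕ → L) => fun x y => if x = 0 ∧ y = n then q.1 else q.2 x y)]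
  · congr 1
    ext f
    simp only [Set.mem_image, Set.mem_prod, Set.mem_ofPred_eq, Prod.exists]
    constructor
    · rintro ⟨hf, h0⟩
      refine ⟨f 0 n, fun x y => if x = 0 ∧ y = n then e else f x y,
        ⟨(hf.1 _ _ h0).2.2, ⟨?_, ?_⟩, by simp⟩, ?_⟩
      · intro x y hxy
        have := hf.1 x y
        grind
      · intro x y x' y' h h'
        have := hf.2 x y x' y'
        grind
      · funext x y
        grind
    · rintro ⟨s, g, ⟨hs, hg, h0⟩, rfl⟩
      have hse : s ≠ e := fun h => he (h ▸ hs)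
      refine ⟨⟨?_, ?_⟩, by simpa using hse⟩
      · intro x y hxy
        have := hg.1 x y
        grind
      · intro x y x' y' h h'
        have := hg.2 x y x' y'
        have h1 := hg.1 x y
        have h2 := hg.1 x' y'
        grind
  · rintro ⟨s, g⟩ ⟨hs, hg, h0⟩ ⟨s', g'⟩ ⟨hs', hg', h0'⟩ h
    have h1 : s = s' := by simpa using congrFun (congrFun h 0) n
    refine Prod.ext h1 ?_
    funext x y
    have h2 := congrFun (congrFun h x) y
    grind

theorem ncard_setOf [Finite L] (he : e ∉ S) {n : ℕ} (hn : 1 ≤ n) :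
    {f | IsDissection e S n f}.ncard =
      if n = 1 then 1 else (S.ncard + 1) * {f | IsDissection e S n f ∧ f 0 n = e}.ncard := by
  split_ifs with h
  · rw [h, setOf_one, Set.ncard_singleton]
  · have hU : {f | IsDissection e S n f} = {f | IsDissection e S n f ∧ f 0 n ≠ e} ∪
        {f | IsDissection e S n f ∧ f 0 n = e} := by
      ext f
      simp only [Set.mem_union, Set.mem_ofPred_eq]
      tauto
    rw [hU, Set.ncard_union_eq _ ((finite_setOf n).subset fun f hf => hf.1)
      ((finite_setOf n).subset fun f hf => hf.1), ncard_base_ne he (by omega), add_mul, one_mul]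
    exact Set.disjoint_left.2 fun f hf hf' => hf.2 hf'.2

theorem ncard_left [Finite L] (he : e ∉ S) {n : ℕ} (hn : 1 ≤ n) :
    {f | IsDissection e S n f ∧ (n = 1 ∨ f 0 n ≠ e)}.ncard =
      if n = 1 then 1 else S.ncard * {f | IsDissection e S n f ∧ f 0 n = e}.ncard := by
  split_ifs with h
  · simp [h, setOf_one]
  · simpa [h] using ncard_base_ne he (n := n) (by omega)

/-- The dissections of the polygon on `0, …, n` whose face containing the base has `j` as its
second vertex correspond to pairs of dissections on `0, …, j` and `j, …, n`. -/
theorem ncard_glue {n j : ℕ} (hj : 1 ≤ j) (hjn : j < n) :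
    {f | (IsDissection e S n f ∧ f 0 n = e) ∧
        ((j = 1 ∨ f 0 j ≠ e) ∧ ∀ i, j < i → f 0 i = e)}.ncard =
      {f | IsDissection e S j f ∧ (j = 1 ∨ f 0 j ≠ e)}.ncard *
        {f | IsDissection e S (n - j) f}.ncard := by
  classical
  rw [← Set.ncard_prod, ← Set.InjOn.ncard_image
    (f := fun q : (ℕ → ℕ → L) × (ℕ → ℕ → L) => fun x y =>
      if y ≤ j then q.1 x y else if j ≤ x then q.2 (x - j) (y - j) else e)]
  · congr 1
    ext f
    simp only [Set.mem_image, Set.mem_prod, Set.mem_ofPred_eq, Prod.exists]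
    constructor
    · rintro ⟨⟨hf, h0⟩, hfj, hmax⟩
      refine ⟨fun x y => if y ≤ j then f x y else e, fun x y => f (x + j) (y + j),
        ⟨⟨⟨?_, ?_⟩, by simpa using hfj⟩, ⟨?_, ?_⟩⟩, ?_⟩
      · intro x y hxy
        have := hf.1 x y
        grind
      · intro x y x' y' h h'
        have := hf.2 x y x' y'
        grind
      · intro x y hxy
        have := hf.1 _ _ hxy
        refine ⟨by omega, by omega, this.2.2⟩
      · intro x y x' y' h h'
        have := hf.2 _ _ _ _ h h'
        omega
      · funext x y
        have h1 := hf.2 0 j x y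
        have h2 := hf.1 x y
        have h3 := hmax y
        rcases Nat.eq_zero_or_pos x with rfl | hx <;> grind
    · rintro ⟨g, h, ⟨⟨hg, hgj⟩, hh⟩, rfl⟩
      refine ⟨⟨⟨?_, ?_⟩, by grind⟩, by simpa using hgj, by grind⟩
      · intro x y hxy
        have h1 := hg.1 x y
        have h2 := hh.1 (x - j) (y - j)
        grind
      · intro x y x' y' hxy hxy'
        have h1 := hg.1 x y
        have h2 := hh.1 (x - j) (y - j)
        have h1' := hg.1 x' y'
        have h2' := hh.1 (x' - j) (y' - j)
        have h3 := hg.2 x y x' y'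
        have h4 := hh.2 (x - j) (y - j) (x' - j) (y' - j)
        grind
  · rintro ⟨g, h⟩ ⟨⟨hg, -⟩, hh⟩ ⟨g', h'⟩ ⟨⟨hg', -⟩, hh'⟩ heq
    refine Prod.ext ?_ ?_
    · funext x y
      have h1 := congrFun (congrFun heq x) y
      have h2 := hg.1 x y
      have h3 := hg'.1 x y
      grind
    · funext x y
      have h1 := congrFun (congrFun heq (x + j)) (y + j)
      have h2 := hh.1 x y
      have h3 := hh'.1 x y
      rcases Nat.eq_zero_or_pos y with rfl | hy
      · have hx : h x 0 = e := not_not.1 fun hne => by have := h2 hne; omega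
        have hx' : h' x 0 = e := not_not.1 fun hne => by have := h3 hne; omega
        exact hx.trans hx'.symm
      · grind

end IsDissection

theorem Set.ncard_eq_sum_of_existsUnique {α ι : Type*} {s : Set α} (hs : s.Finite) (t : Finset ι)
    (R : ι → α → Prop) (h : ∀ a ∈ s, ∃! i, i ∈ t ∧ R i a) :
    s.ncard = ∑ i ∈ t, {a | a ∈ s ∧ R i a}.ncard := by
  classical
  have hfin (i : ι) : {a | a ∈ s ∧ R i a}.Finite := hs.subset fun a ha => ha.1
  have hU : hs.toFinset = t.biUnion fun i => (hfin i).toFinset := by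
    ext a
    simp only [Set.Finite.mem_toFinset, Finset.mem_biUnion, Set.mem_ofPred_eq]
    exact ⟨fun ha => let ⟨i, hi, _⟩ := h a ha; ⟨i, hi.1, ha, hi.2⟩, fun ⟨_, _, ha, _⟩ => ha⟩
  rw [Set.ncard_eq_toFinset_card s hs, hU, Finset.card_biUnion]
  · exact Finset.sum_congr rfl fun i _ => (Set.ncard_eq_toFinset_card _ (hfin i)).symm
  · intro i hi j hj hij
    refine Finset.disjoint_left.2 fun a hai haj => hij ?_
    simp only [Set.Finite.mem_toFinset, Set.mem_ofPred_eq] at hai haj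
    exact (h a hai.1).unique ⟨hi, hai.2⟩ ⟨hj, haj.2⟩

theorem IsDissection.ncard_base_eq {L : Type*} [Finite L] {e : L} {S : Set L} (he : e ∉ S) {n : ℕ}
    (hn : 2 ≤ n) :
    {f | IsDissection e S n f ∧ f 0 n = e}.ncard = ∑ j ∈ Finset.Icc 1 (n - 1),
      (if j = 1 then 1 else S.ncard * {f | IsDissection e S j f ∧ f 0 j = e}.ncard) *
      (if n - j = 1 then 1 else
        (S.ncard + 1) * {f | IsDissection e S (n - j) f ∧ f 0 (n - j) = e}.ncard) := by
  classical
  rw [Set.ncard_eq_sum_of_existsUnique ((finite_setOf n).subset fun f hf => hf.1)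
    (Finset.Icc 1 (n - 1)) fun j f => (j = 1 ∨ f 0 j ≠ e) ∧ ∀ i, j < i → f 0 i = e]
  · refine Finset.sum_congr rfl fun j hj => ?_
    obtain ⟨hj1, hj2⟩ := Finset.mem_Icc.1 hj
    rw [← ncard_left he hj1, ← ncard_setOf he (by omega), ← ncard_glue hj1 (by omega)]
    rfl
  · rintro f ⟨hf, h0⟩
    have hspec := Nat.findGreatest_spec (P := fun i => i = 1 ∨ f 0 i ≠ e) (m := 1) (n := n - 1)
      (by omega) (Or.inl rfl)
    have hle := Nat.findGreatest_le (P := fun i => i = 1 ∨ f 0 i ≠ e) (n - 1)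
    have hge := Nat.le_findGreatest (P := fun i => i = 1 ∨ f 0 i ≠ e) (m := 1) (n := n - 1)
      (by omega) (Or.inl rfl)
    have hgt (i : ℕ) := Nat.findGreatest_is_greatest
      (P := fun i => i = 1 ∨ f 0 i ≠ e) (k := i) (n := n - 1)
    generalize Nat.findGreatest (fun i => i = 1 ∨ f 0 i ≠ e) (n - 1) = j at *
    have hmax (i : ℕ) (hi : j < i) : f 0 i = e := by
      by_contra h
      have h1 := hf.1 0 i h
      have h2 : i ≠ n := fun hin => h (hin ▸ h0)
      exact hgt i hi (by omega) (Or.inr h)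
    refine ⟨j, ⟨Finset.mem_Icc.2 ⟨hge, hle⟩, hspec, hmax⟩, ?_⟩
    rintro k ⟨hk, hkspec, hkmax⟩
    have := (Finset.mem_Icc.1 hk).1
    rcases lt_trichotomy k j with h | h | h
    · have := hkmax j h
      grind
    · exact h
    · have := hmax k h
      grind

/-- A dual clique amounts to a label for the base, labels for the edges, and a dissection. -/
noncomputable def dualCliqueEquiv (M : Type) [One M] (n : ℕ) (hn : 2 ≤ n) :
    DualClique M n ≃ M × (Fin n → M) ×
      {f | IsDissection ((1, 1) : M × M) {p | p.1 ≠ p.2} n f ∧ f 0 n = (1, 1)} := by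
  classical
  refine
  { toFun := fun p => ⟨(p.1 ⟨(0, Fin.last n), by simp [Fin.lt_def]; omega⟩).1,
      fun i => (p.1 ⟨(i.castSucc, i.succ), Fin.castSucc_lt_succ⟩).1,
      fun x y => if h : x + 2 ≤ y ∧ y ≤ n ∧ ¬ (x = 0 ∧ y = n) then
        p.1 ⟨(⟨x, by omega⟩, ⟨y, by omega⟩), by simp [Fin.lt_def]; omega⟩ else (1, 1), ?_⟩
    invFun := fun q => ⟨fun a => if a.IsBase then (q.1, q.1) else
      if h : a.IsEdge then
        (q.2.1 ⟨a.1.1, by have := a.1.2.2; unfold Arc.IsEdge at h; omega⟩,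
          q.2.1 ⟨a.1.1, by have := a.1.2.2; unfold Arc.IsEdge at h; omega⟩)
      else q.2.2.1 a.1.1 a.1.2, ?_⟩
    left_inv := ?_
    right_inv := ?_ }
  · obtain ⟨p, ⟨h1, h2, h3⟩, -⟩ := p
    refine ⟨⟨?_, ?_⟩, by simp⟩
    · intro x y hxy
      by_cases h : x + 2 ≤ y ∧ y ≤ n ∧ ¬ (x = 0 ∧ y = n)
      · simp only [dif_pos h] at hxy ⊢
        exact ⟨h.1, h.2.1, h2 _ ⟨h.2.2, by simp only [Arc.IsEdge]; omega⟩ hxy⟩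
      · exact absurd (dif_neg h) hxy
    · intro x y x' y' hxy hxy' hc
      by_cases h : x + 2 ≤ y ∧ y ≤ n ∧ ¬ (x = 0 ∧ y = n)
      · by_cases h' : x' + 2 ≤ y' ∧ y' ≤ n ∧ ¬ (x' = 0 ∧ y' = n)
        · simp only [dif_pos h] at hxy
          simp only [dif_pos h'] at hxy'
          refine h3 _ _ ⟨?_, ?_⟩ ⟨?_, ?_⟩ hxy hxy' (Or.inl hc) <;>
            simp only [Arc.IsBase, Arc.IsEdge] <;> omega
        · exact absurd (dif_neg h') hxy'
      · exact absurd (dif_neg h) hxy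
  · obtain ⟨b, u, f, hf, h0⟩ := q
    refine ⟨⟨?_, ?_, ?_⟩, by omega⟩
    · intro a ha
      by_cases hb : a.IsBase
      · simp [hb]
      · simp [hb, ha.resolve_left hb]
    · intro a ha hne
      simp only [if_neg ha.1, dif_neg ha.2] at hne ⊢
      exact (hf.1 _ _ hne).2.2
    · intro a a' ha ha' hne hne' hc
      simp only [if_neg ha.1, dif_neg ha.2] at hne
      simp only [if_neg ha'.1, dif_neg ha'.2] at hne'
      exact hc.elim (hf.2 _ _ _ _ hne hne') (hf.2 _ _ _ _ hne' hne)
  · rintro ⟨p, ⟨h1, h2, h3⟩, h4⟩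
    refine Subtype.ext (funext fun a => ?_)
    obtain ⟨⟨x, y⟩, hxy⟩ := a
    have hlt : (x : ℕ) < y := hxy
    by_cases hb : Arc.IsBase ⟨(x, y), hxy⟩
    · have hx : x = 0 := Fin.ext hb.1
      have hy : y = Fin.last n := Fin.ext hb.2
      subst hx hy
      simp only [if_pos hb]
      exact Prod.ext rfl (h1 _ (Or.inl hb))
    · by_cases hd : Arc.IsEdge ⟨(x, y), hxy⟩
      · have hx : (x : ℕ) < n := by have := y.2; omega
        obtain ⟨i, rfl⟩ : ∃ i : Fin n, x = i.castSucc := ⟨⟨x, hx⟩, rfl⟩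
        obtain rfl : y = i.succ := Fin.ext hd
        simp only [if_neg hb, dif_pos hd]
        exact Prod.ext rfl (h1 _ (Or.inr hd))
      · have : (x : ℕ) + 2 ≤ y ∧ (y : ℕ) ≤ n ∧ ¬ ((x : ℕ) = 0 ∧ (y : ℕ) = n) :=
          ⟨by simp only [Arc.IsEdge] at hd; omega, by omega, hb⟩
        simp only [if_neg hb, dif_neg hd, dif_pos this]
  · rintro ⟨b, u, f, hf, h0⟩
    refine Prod.ext ?_ (Prod.ext ?_ (Subtype.ext ?_))
    · simp [Arc.IsBase]
    · funext i
      have : ¬ ((i : ℕ) = 0 ∧ (i : ℕ) + 1 = n) := by omega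
      simp [Arc.IsBase, Arc.IsEdge, this]
    · funext x y
      by_cases h : x + 2 ≤ y ∧ y ≤ n ∧ ¬ (x = 0 ∧ y = n)
      · have h' : y ≠ x + 1 := by omega
        simp [Arc.IsBase, Arc.IsEdge, h, h']
      · simp only [dif_neg h]
        by_contra hne
        have := hf.1 x y (Ne.symm hne)
        refine hne ?_
        obtain ⟨rfl, rfl⟩ : x = 0 ∧ y = n := by tauto
        exact h0.symm

theorem dualCount_eq_mul_ncard (M : Type) [One M] [Fintype M] (n : ℕ) (hn : 2 ≤ n) :
    dualCount M n = Fintype.card M ^ (n + 1) *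
      {f | IsDissection ((1, 1) : M × M) {p | p.1 ≠ p.2} n f ∧ f 0 n = (1, 1)}.ncard := by
  rw [dualCount, Nat.card_congr (dualCliqueEquiv M n hn), Nat.card_prod, Nat.card_prod,
    Nat.card_coe_set_eq, Nat.card_eq_fintype_card, Nat.card_eq_fintype_card, Fintype.card_fun,
    Fintype.card_fin, pow_succ', mul_assoc]

theorem ncard_setOf_fst_ne_snd (M : Type*) [Fintype M] :
    {p : M × M | p.1 ≠ p.2}.ncard = Fintype.card M * (Fintype.card M - 1) := by
  classical
  have : {p : M × M | p.1 ≠ p.2} = (Finset.univ.offDiag : Finset (M × M)) := by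
    ext p
    simp
  rw [this, Set.ncard_coe_finset, Finset.offDiag_card, Finset.card_univ, Nat.mul_sub_one]

theorem Nat.dvd_choose_mul_choose_succ (N k : ℕ) : N ∣ N.choose k * N.choose (k + 1) := by
  rcases N with _ | M
  · simp
  rcases lt_or_ge (M + 1) k with h | h
  · simp [Nat.choose_eq_zero_of_lt h]
  have h1 := Nat.add_one_mul_choose_eq M k
  have h2 := Nat.choose_mul_succ_eq M k
  have h3 : (M + 1) * ((M + 1).choose k * (M + 1).choose (k + 1)) +
      (M + 1).choose k * (M + 1).choose (k + 1) =
      (M + 1) * (M.choose k * ((M + 1).choose k + (M + 1).choose (k + 1))) := by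
    zify [h] at h1 h2 ⊢
    linear_combination -((M + 1).choose k : ℤ) * h1 - ((M + 1).choose (k + 1) : ℤ) * h2
  exact (Nat.dvd_add_right (dvd_mul_right _ _)).1 (h3 ▸ dvd_mul_right _ _)

/-- For `n ≥ 2`, the number of dual `M`-cliques of arity `n` equals
`Σ_{k=0}^{n−2} m^{n+1} (m(m−1)+1)^k (m(m−1))^{n−k−2} nar(n,k)`, `m = #M`. -/
theorem statement15 (M : Type) [MulOneClass M] [Fintype M] (n : ℕ) (hn : 2 ≤ n) :
    dualCount M n
      = ∑ k ∈ Finset.range (n - 1),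
          Fintype.card M ^ (n + 1)
            * (Fintype.card M * (Fintype.card M - 1) + 1) ^ k
            * (Fintype.card M * (Fintype.card M - 1)) ^ (n - k - 2)
            * nar n k := by
  have hN : (((n - 1 : ℕ) : ℚ)) ≠ 0 := by
    have : n - 1 ≠ 0 := by omega
    exact_mod_cast this
  have hmain := mul_eq_sum_choose_of_convolution
    (({p : M × M | p.1 ≠ p.2}.ncard : ℕ) : ℚ)
    (fun n => ({f | IsDissection ((1, 1) : M × M) {p | p.1 ≠ p.2} n f ∧ f 0 n = (1, 1)}.ncard : ℚ))
    (fun n hn => by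
      rw [IsDissection.ncard_base_eq (by simp) hn]
      push_cast
      rfl) (n - 1) (by omega)
  rw [Nat.sub_add_cancel (by omega : 1 ≤ n), ncard_setOf_fst_ne_snd] at hmain
  rw [dualCount_eq_mul_ncard M n hn]
  apply Nat.cast_injective (R := ℚ)
  apply mul_left_cancel₀ hN
  rw [Nat.cast_mul, mul_left_comm, hmain]
  generalize Fintype.card M * (Fintype.card M - 1) = w
  push_cast
  rw [Finset.mul_sum, Finset.mul_sum]
  refine Finset.sum_congr rfl fun k hk => ?_
  have hnar : ((n - 1 : ℕ) : ℚ) * nar n k = (n - 1).choose k * (n - 1).choose (k + 1) := by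
    rw [nar]
    exact_mod_cast Nat.mul_div_cancel' (Nat.dvd_choose_mul_choose_succ (n - 1) k)
  rw [← hnar, show n - 1 - 1 - k = n - k - 2 by omega]
  ring
end
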